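/- Let G = PSL₂(q) where q = p^e > 9 with p an odd prime and e even. If G admits an unmixed Beauville structure of type ((r₁,s₁,t₁),(r₂,s₂,t₂)), then g = gcd(r₁s₁t₁, r₂s₂t₂) ∈ {1, p, p²}. Moreover, if p divides g and for some i ∈ {1,2} the triple (rᵢ,sᵢ,tᵢ) is, up to permutation, equal to (p,p,n), then n ≠ p and n is a good G-order with respect to q. -/

import Mathlib

open Matrix

/-- The projective special linear group `PSL₂(F) = SL(2, F) / Z(SL(2, F))`. -/
abbrev PSL2 (F : Type*) [Field F] :=
  Matrix.SpecialLinearGroup (Fin 2) F ⧸ Subgroup.center (Matrix.SpecialLinearGroup (Fin 2) F)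

/-- `Σ(a)`: the union of the conjugacy classes of all powers of `a`. -/
def conjPowers {G : Type*} [Group G] (a : G) : Set G :=
  {x | ∃ (g : G) (j : ℕ), x = g * a ^ j * g⁻¹}

/-- `Σ(a, b, c)`: the union of the conjugacy classes of all powers of `a`, of `b`, and
of `c`. -/
def sigma3 {G : Type*} [Group G] (a b c : G) : Set G :=
  conjPowers a ∪ conjPowers b ∪ conjPowers c

/-- An unmixed Beauville structure for a group `G`: two triples, each with product `1` and
generating `G`, whose `Σ`-sets intersect trivially. -/
def IsUnmixedBeauville {G : Type*} [Group G] (a₁ b₁ c₁ a₂ b₂ c₂ : G) : Prop :=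
  a₁ * b₁ * c₁ = 1 ∧ a₂ * b₂ * c₂ = 1 ∧
  Subgroup.closure ({a₁, b₁} : Set G) = ⊤ ∧ Subgroup.closure ({a₂, b₂} : Set G) = ⊤ ∧
  sigma3 a₁ b₁ c₁ ∩ sigma3 a₂ b₂ c₂ = {1}

/-- `G` admits an unmixed Beauville structure of type `((r₁,s₁,t₁),(r₂,s₂,t₂))`. -/
def HasBeauvilleOfType (G : Type*) [Group G] (r₁ s₁ t₁ r₂ s₂ t₂ : ℕ) : Prop :=
  ∃ a₁ b₁ c₁ a₂ b₂ c₂ : G, IsUnmixedBeauville a₁ b₁ c₁ a₂ b₂ c₂ ∧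
    orderOf a₁ = r₁ ∧ orderOf b₁ = s₁ ∧ orderOf c₁ = t₁ ∧
    orderOf a₂ = r₂ ∧ orderOf b₂ = s₂ ∧ orderOf c₂ = t₂

/-- `n` is a *good `G`-order* with respect to `q = p ^ e` (for `G = PSL₂(q)`, `q` odd):
`n > 1` and either `n` divides `(q-1)/2` and some primitive `2n`-th root of unity `a` of
`𝔽_q` has `-a` a square in `𝔽_q`, or `n` divides `(q+1)/2` and some primitive `2n`-th root
of unity `a` of `𝔽_{q²}` satisfies `-a = c ^ 2` for some `c ∈ 𝔽_{q²}` with `c ^ (q+1) = 1`. -/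
def IsGoodGOrder (p e : ℕ) [Fact p.Prime] (n : ℕ) : Prop :=
  1 < n ∧
  ((n ∣ (p ^ e - 1) / 2 ∧
      ∃ a : GaloisField p e, orderOf a = 2 * n ∧ ∃ c : GaloisField p e, -a = c ^ 2) ∨
   (n ∣ (p ^ e + 1) / 2 ∧
      ∃ a : GaloisField p (2 * e), orderOf a = 2 * n ∧
        ∃ c : GaloisField p (2 * e), -a = c ^ 2 ∧ c ^ (p ^ e + 1) = 1))

section TwoByTwo

variable {F : Type*} [Field F]

theorem mul_self_of_det_eq_one {R : Type*} [CommRing R] (M : Matrix (Fin 2) (Fin 2) R)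
    (h : M.det = 1) : M * M = M.trace • M - 1 := by
  rw [det_fin_two] at h
  ext i j
  fin_cases i <;> fin_cases j <;> simp [mul_apply, trace_fin_two] <;>
    first | ring1 | linear_combination -h

namespace PSL2

theorem mk_eq_one_iff (X : SpecialLinearGroup (Fin 2) F) :
    (X : PSL2 F) = 1 ↔ X = 1 ∨ X = -1 := by
  rw [QuotientGroup.eq_one_iff, Matrix.SpecialLinearGroup.mem_center_iff]
  constructor
  · rintro ⟨r, hr, hX⟩
    rw [Fintype.card_fin, sq_eq_one_iff] at hr
    refine hr.imp (fun h => ?_) (fun h => ?_) <;>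
    · apply Subtype.ext
      rw [← hX, h]
      simp [← smul_one_eq_diagonal]
  · rintro (rfl | rfl)
    · exact ⟨1, by simp, by simp⟩
    · exact ⟨-1, by simp, by simp [← smul_one_eq_diagonal]⟩

theorem mk_neg (X : SpecialLinearGroup (Fin 2) F) :
    ((-X : SpecialLinearGroup (Fin 2) F) : PSL2 F) = X := by
  rw [QuotientGroup.eq, ← QuotientGroup.eq_one_iff, mk_eq_one_iff]
  right
  simp

theorem pow_char_eq_one_of_trace_eq_two (p : ℕ) [hp : Fact p.Prime] [CharP F p]
    (X : SpecialLinearGroup (Fin 2) F) (h : X.1.trace = 2) : X ^ p = 1 := by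
  have h2 : (X.1 - 1) ^ 2 = 0 := by
    have := mul_self_of_det_eq_one X.1 X.2
    rw [sq, sub_mul, mul_sub, this, h, two_smul]
    simp only [mul_one, one_mul]
    abel
  have hp0 : (X.1 - 1) ^ p = 0 := pow_eq_zero_of_le hp.out.two_le h2
  rw [sub_pow_char_of_commute p (Commute.one_right _), one_pow, sub_eq_zero] at hp0
  apply Subtype.ext
  simpa using hp0

theorem mk_pow_char_eq_one (p : ℕ) [hp : Fact p.Prime] [CharP F p]
    (X : SpecialLinearGroup (Fin 2) F) (h : X.1.trace = 2 ∨ X.1.trace = -2) :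
    (X : PSL2 F) ^ p = 1 := by
  rcases h with h | h
  · rw [← QuotientGroup.mk_pow, pow_char_eq_one_of_trace_eq_two p X h, QuotientGroup.mk_one]
  · rw [← mk_neg, ← QuotientGroup.mk_pow, pow_char_eq_one_of_trace_eq_two p (-X),
      QuotientGroup.mk_one]
    simp [h]

theorem exists_lift_trace_eq_two (p : ℕ) [hp : Fact p.Prime] [CharP F p] (hodd : Odd p)
    (x : PSL2 F) (hx : x ^ p = 1) :
    ∃ X : SpecialLinearGroup (Fin 2) F, (X : PSL2 F) = x ∧ X.1.trace = 2 := by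
  have key : ∀ X : SpecialLinearGroup (Fin 2) F, X ^ p = 1 → X.1.trace = 2 := by
    intro X hX
    have h0 : (X.1 - 1) ^ p = 0 := by
      rw [sub_pow_char_of_commute p (Commute.one_right _), one_pow, sub_eq_zero]
      simpa using congrArg Subtype.val hX
    have h1 : (X.1 - 1).det = 0 := by
      have := congrArg det h0
      rw [det_pow, det_zero] at this
      exact pow_eq_zero_iff hp.out.ne_zero |>.1 this
    have h2 := X.2
    rw [det_fin_two] at h1 h2
    rw [trace_fin_two]
    simp at h1
    linear_combination h2 - h1
  obtain ⟨X, rfl⟩ := QuotientGroup.mk_surjective x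
  rw [← QuotientGroup.mk_pow, mk_eq_one_iff] at hx
  rcases hx with hx | hx
  · exact ⟨X, rfl, key X hx⟩
  · refine ⟨-X, mk_neg X, key _ ?_⟩
    rw [hodd.neg_pow, hx, neg_neg]

theorem mk_pow_eq_one_iff {K : Type*} [Field K] [Algebra F K] (X : SpecialLinearGroup (Fin 2) F)
    (l : K) (hl0 : l ≠ 0) (hl : l + l⁻¹ = algebraMap F K X.1.trace) (hl1 : l ^ 2 ≠ 1) (k : ℕ) :
    (X : PSL2 F) ^ k = 1 ↔ (l ^ 2) ^ k = 1 := by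
  set f := (algebraMap F K).mapMatrix (m := Fin 2) with hf
  have hfinj : Function.Injective f := Matrix.map_injective (algebraMap F K).injective
  have hM : f X.1 * f X.1 = (l + l⁻¹) • f X.1 - 1 := by
    rw [← map_mul, mul_self_of_det_eq_one X.1 X.2, map_sub, map_one, hl]
    congr 1
    ext i j
    simp [hf]
  rw [← QuotientGroup.mk_pow, mk_eq_one_iff]
  have e1 : ∀ ε : F, ε = 1 ∨ ε = -1 → (X.1 ^ k = ε • 1 ↔ l ^ k = algebraMap F K ε) := by
    intro ε hε
    constructor
    · intro h
      have hdet : (f X.1 - l • 1).det = 0 := by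
        have h2 := X.2
        rw [det_fin_two] at h2 ⊢
        have h2' := congrArg (algebraMap F K) h2
        rw [trace_fin_two] at hl
        simp [hf] at h2' hl ⊢
        have : l * l⁻¹ = 1 := mul_inv_cancel₀ hl0
        linear_combination h2' + l * hl - this
      have hc : Commute (f X.1) (l • 1) := by
        simp [Commute, SemiconjBy]
      obtain ⟨N, hN⟩ := hc.sub_dvd_pow_sub_pow k
      have h3 : f X.1 ^ k = (algebraMap F K ε) • 1 := by
        rw [← map_pow, h]
        ext i j
        by_cases hij : i = j <;> simp [hf, hij]
      rw [h3, smul_pow, one_pow, ← sub_smul] at hN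
      have := congrArg det hN
      rw [det_mul, hdet, zero_mul, det_smul, det_one, mul_one] at this
      have := pow_eq_zero_iff (by simp) |>.1 this
      exact (sub_eq_zero.1 this).symm
    · intro h
      apply hfinj
      have hd1 : (Polynomial.X - Polynomial.C l) ∣
          (Polynomial.X ^ k - Polynomial.C (algebraMap F K ε)) := by
        rw [Polynomial.dvd_iff_isRoot]; simp [h]
      have hd2 : (Polynomial.X - Polynomial.C l⁻¹) ∣
          (Polynomial.X ^ k - Polynomial.C (algebraMap F K ε)) := by
        rw [Polynomial.dvd_iff_isRoot]
        rcases hε with rfl | rfl <;> simp [h]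
      have hne : l ≠ l⁻¹ := by
        intro h'
        apply hl1
        rw [sq]
        nth_rw 2 [h']
        exact mul_inv_cancel₀ hl0
      obtain ⟨g, hg⟩ := (Polynomial.isCoprime_X_sub_C_of_isUnit_sub
        (sub_ne_zero.2 hne).isUnit).mul_dvd hd1 hd2
      have := congrArg (Polynomial.aeval (f X.1)) hg
      have h0 : (f X.1 - algebraMap K _ l) * (f X.1 - algebraMap K _ l⁻¹) = 0 := by
        rw [sub_mul, mul_sub, mul_sub, hM, ← map_mul, mul_inv_cancel₀ hl0, ← Algebra.commutes,
          ← Algebra.smul_def, ← Algebra.smul_def, add_smul, map_one]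
        abel
      simp only [map_sub, map_mul, map_pow, Polynomial.aeval_X, Polynomial.aeval_C, h0,
        zero_mul] at this
      rw [sub_eq_zero] at this
      rw [map_pow, this]
      ext i j
      by_cases hij : i = j <;> simp [hf, Matrix.algebraMap_matrix_apply, hij]
  have e2 : X ^ k = 1 ↔ l ^ k = 1 := by
    refine Subtype.ext_iff.trans ?_
    simpa using e1 1 (Or.inl rfl)
  have e3 : X ^ k = -1 ↔ l ^ k = -1 := by
    refine Subtype.ext_iff.trans ?_
    simpa using e1 (-1) (Or.inr rfl)
  rw [e2, e3, ← pow_mul, mul_comm, pow_mul, sq_eq_one_iff]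

theorem trace_pow_eq {K : Type*} [Field K] [Algebra F K] (X : SpecialLinearGroup (Fin 2) F)
    (l : K) (hl0 : l ≠ 0) (hl : l + l⁻¹ = algebraMap F K X.1.trace) (k : ℕ) :
    algebraMap F K (X ^ k).1.trace = l ^ k + (l ^ k)⁻¹ := by
  induction k using Nat.twoStepInduction with
  | zero => simpa [one_add_one_eq_two] using map_ofNat (algebraMap F K) 2
  | one => simp [hl]
  | more n h1 h2 =>
    have h3 : (X ^ (n + 2)).1 = X.1.trace • (X ^ (n + 1)).1 - (X ^ n).1 := by
      have hp (j : ℕ) : (X ^ j).1 = X.1 ^ j := rfl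
      rw [hp, hp, hp, pow_succ, pow_succ, mul_assoc]
      rw [mul_self_of_det_eq_one X.1 X.2]
      simp [mul_sub]
    rw [h3, trace_sub, trace_smul, smul_eq_mul, map_sub, map_mul, h1, h2, ← hl]
    field_simp
    ring

theorem exists_add_inv_eq {K : Type*} [Field K] (h2 : (2 : K) ≠ 0) (t d : K)
    (hd : d ^ 2 = t ^ 2 - 4) : ∃ l : K, l ≠ 0 ∧ l + l⁻¹ = t ∧ 2 * l = t + d := by
  have h : (t + d) / 2 * ((t - d) / 2) = 1 := by
    field_simp
    linear_combination -hd
  refine ⟨(t + d) / 2, left_ne_zero_of_mul_eq_one h, ?_⟩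
  rw [inv_eq_of_mul_eq_one_right h]
  constructor <;> field_simp
  ring

theorem sq_eq_one_iff_add_inv {K : Type*} [Field K] (l t : K) (h0 : l ≠ 0) (hl : l + l⁻¹ = t) :
    l ^ 2 = 1 ↔ t = 2 ∨ t = -2 := by
  have h : (t - 2) * (t + 2) * l ^ 2 = (l ^ 2 - 1) ^ 2 := by
    rw [← hl]
    field_simp
    ring
  rw [← sub_eq_zero, ← pow_eq_zero_iff two_ne_zero, ← h, mul_eq_zero, mul_eq_zero, sub_eq_zero,
    add_eq_zero_iff_eq_neg]
  simp [h0]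

theorem orderOf_mk {K : Type*} [Field K] [Algebra F K] (X : SpecialLinearGroup (Fin 2) F)
    (l : K) (hl0 : l ≠ 0) (hl : l + l⁻¹ = algebraMap F K X.1.trace)
    (h : ¬(X.1.trace = 2 ∨ X.1.trace = -2)) :
    orderOf (X : PSL2 F) = orderOf (l ^ 2) := by
  refine orderOf_eq_orderOf_iff.2 fun k => mk_pow_eq_one_iff X l hl0 hl ?_ k
  rw [Ne, sq_eq_one_iff_add_inv l _ hl0 hl, ← map_ofNat (algebraMap F K) 2, ← map_neg,
    (algebraMap F K).injective.eq_iff, (algebraMap F K).injective.eq_iff]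
  exact h

theorem exists_algebraicClosure_add_inv_eq_trace (h2 : (2 : F) ≠ 0)
    (X : SpecialLinearGroup (Fin 2) F) :
    ∃ l : AlgebraicClosure F, l ≠ 0 ∧ l + l⁻¹ = algebraMap F _ X.1.trace := by
  obtain ⟨d, hd⟩ := IsAlgClosed.exists_pow_nat_eq
    ((algebraMap F (AlgebraicClosure F) X.1.trace) ^ 2 - 4) (n := 2) (by simp)
  have h2' : (2 : AlgebraicClosure F) ≠ 0 := by
    rw [← map_ofNat (algebraMap F (AlgebraicClosure F)) 2]
    simpa using h2
  obtain ⟨l, hl0, hl, -⟩ := exists_add_inv_eq h2' _ d hd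
  exact ⟨l, hl0, hl⟩

theorem not_char_dvd_orderOf_mk [Finite F] (p : ℕ) [hp : Fact p.Prime] [CharP F p]
    (h2 : (2 : F) ≠ 0) (X : SpecialLinearGroup (Fin 2) F)
    (h : ¬(X.1.trace = 2 ∨ X.1.trace = -2)) : ¬ p ∣ orderOf (X : PSL2 F) := by
  obtain ⟨l, hl0, hl⟩ := exists_algebraicClosure_add_inv_eq_trace h2 X
  have ho := orderOf_mk X l hl0 hl h
  have hpos := orderOf_pos (X : PSL2 F)
  rintro ⟨m, hm⟩
  have : CharP (AlgebraicClosure F) p := charP_of_injective_algebraMap (algebraMap F _).injective p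
  have h1 : ((l ^ 2) ^ m) ^ p = 1 ^ p := by
    rw [← pow_mul, mul_comm, ← hm, ho, pow_orderOf_eq_one, one_pow]
  have h3 := frobenius_inj (AlgebraicClosure F) p h1
  have hm0 : 0 < m := Nat.pos_of_ne_zero (by rintro rfl; rw [hm] at hpos; simp at hpos)
  have h4 := Nat.le_of_dvd hm0 (orderOf_dvd_of_pow_eq_one h3)
  rw [← ho, hm] at h4
  have := hp.out.two_le
  nlinarith

theorem orderOf_eq_of_dvd [Finite F] (p : ℕ) [hp : Fact p.Prime] [CharP F p]
    (h2 : (2 : F) ≠ 0) (x : PSL2 F) (h : p ∣ orderOf x) : orderOf x = p := by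
  obtain ⟨X, rfl⟩ := QuotientGroup.mk_surjective x
  by_cases ht : X.1.trace = 2 ∨ X.1.trace = -2
  · exact Nat.dvd_antisymm (orderOf_dvd_of_pow_eq_one (mk_pow_char_eq_one p X ht)) h
  · exact absurd h (not_char_dvd_orderOf_mk p h2 X ht)

theorem exists_binary_quadratic_eq_one [Finite F] (h2 : (2 : F) ≠ 0) (a b c : F)
    (hD : b ^ 2 - 4 * a * c ≠ 0) : ∃ x y : F, a * x ^ 2 + b * (x * y) + c * y ^ 2 = 1 := by
  by_cases ha : a = 0
  · subst ha
    have hb : b ≠ 0 := by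
      rintro rfl
      simp at hD
    refine ⟨(1 - c) / b, 1, ?_⟩
    field_simp
    ring
  · have := Fintype.ofFinite F
    have hc2 : ringChar F ≠ 2 := by
      intro h
      apply h2
      have := ringChar.Nat.cast_ringChar (R := F)
      rw [h] at this
      exact_mod_cast this
    set D := b ^ 2 - 4 * a * c with hDd
    obtain ⟨u, y, huy⟩ := FiniteField.exists_root_sum_quadratic (R := F)
      (f := Polynomial.X ^ 2 - Polynomial.C (4 * a)) (g := Polynomial.C (-D) * Polynomial.X ^ 2)
      (Polynomial.degree_X_pow_sub_C (by decide) _)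
      (Polynomial.degree_C_mul_X_pow 2 (neg_ne_zero.2 hD)) (FiniteField.odd_card_of_char_ne_two hc2)
    simp at huy
    refine ⟨(u - b * y) / (2 * a), y, ?_⟩
    field_simp
    have h4 : (4 : F) ≠ 0 := by
      have : (4 : F) = 2 * 2 := by norm_num
      rw [this]
      exact mul_ne_zero h2 h2
    have : 4 * a = u ^ 2 - D * y ^ 2 := by linear_combination -huy
    rw [hDd] at this
    linear_combination -this

theorem exists_mul_eq_mul_companion [Finite F] (h2 : (2 : F) ≠ 0) (X : SpecialLinearGroup (Fin 2) F)
    (h : ¬(X.1.trace = 2 ∨ X.1.trace = -2)) :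
    ∃ P : SpecialLinearGroup (Fin 2) F, X.1 * P.1 = P.1 * !![0, -1; 1, X.1.trace] := by
  have hdet := X.2
  rw [det_fin_two] at hdet
  rw [trace_fin_two] at h ⊢
  set a := X.1 0 0
  set b := X.1 0 1
  set c := X.1 1 0
  set d := X.1 1 1
  obtain ⟨x, y, hxy⟩ := exists_binary_quadratic_eq_one h2 c (d - a) (-b) (by
    intro h0
    have : (a + d - 2) * (a + d + 2) = 0 := by linear_combination h0 + 4 * hdet
    rcases mul_eq_zero.1 this with h' | h'
    · exact h (Or.inl (by linear_combination h'))
    · exact h (Or.inr (by linear_combination h')))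
  refine ⟨⟨!![x, a * x + b * y; y, c * x + d * y], ?_⟩, ?_⟩
  · rw [det_fin_two_of]
    linear_combination hxy
  · ext i j
    fin_cases i <;> fin_cases j <;> simp [mul_apply]
    · ring
    · linear_combination -x * hdet
    · ring
    · linear_combination -y * hdet

theorem isConj_of_trace_eq [Finite F] (h2 : (2 : F) ≠ 0) (X Y : SpecialLinearGroup (Fin 2) F)
    (h : ¬(X.1.trace = 2 ∨ X.1.trace = -2)) (hXY : X.1.trace = Y.1.trace) :
    ∃ g, Y = g * X * g⁻¹ := by
  obtain ⟨P, hP⟩ := exists_mul_eq_mul_companion h2 X h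
  obtain ⟨Q, hQ⟩ := exists_mul_eq_mul_companion h2 Y (hXY ▸ h)
  have hdet : (!![0, -1; 1, X.1.trace] : Matrix (Fin 2) (Fin 2) F).det = 1 := by
    simp
  set C : SpecialLinearGroup (Fin 2) F := ⟨_, hdet⟩
  have h1 : X * P = P * C := Subtype.ext hP
  have h3 : Y * Q = Q * C := Subtype.ext (by rw [← hXY] at hQ; exact hQ)
  refine ⟨Q * P⁻¹, ?_⟩
  have h4 : C = P⁻¹ * (X * P) := by rw [h1]; group
  rw [eq_mul_inv_iff_mul_eq.2 h3, h4]
  group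

theorem exists_conj_pow_eq [Finite F] (p : ℕ) [hp : Fact p.Prime] [CharP F p]
    (h2 : (2 : F) ≠ 0) (x y : PSL2 F) (hxy : orderOf x = orderOf y)
    (hpx : ¬ p ∣ orderOf x) (hx1 : x ≠ 1) : ∃ g : PSL2 F, ∃ j : ℕ, y = g * x ^ j * g⁻¹ := by
  have key : ∀ X : SpecialLinearGroup (Fin 2) F, orderOf (X : PSL2 F) = orderOf x →
      ¬(X.1.trace = 2 ∨ X.1.trace = -2) := by
    intro X hX ht
    have h3 := orderOf_dvd_of_pow_eq_one (mk_pow_char_eq_one p X ht)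
    rw [hX, Nat.dvd_prime hp.out, orderOf_eq_one_iff] at h3
    rcases h3 with h3 | h3
    · exact hx1 h3
    · exact hpx h3.symm.dvd
  obtain ⟨X, rfl⟩ := QuotientGroup.mk_surjective x
  obtain ⟨Y, rfl⟩ := QuotientGroup.mk_surjective y
  obtain ⟨l, hl0, hl⟩ := exists_algebraicClosure_add_inv_eq_trace h2 X
  obtain ⟨m, hm0, hm⟩ := exists_algebraicClosure_add_inv_eq_trace h2 Y
  have hX := orderOf_mk X l hl0 hl (key X rfl)
  have hY := orderOf_mk Y m hm0 hm (key Y hxy.symm)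
  have hprim : IsPrimitiveRoot (l ^ 2) (orderOf (X : PSL2 F)) := by
    rw [hX]
    exact IsPrimitiveRoot.orderOf _
  have : NeZero (orderOf (X : PSL2 F)) := ⟨(orderOf_pos _).ne'⟩
  obtain ⟨j, -, hj⟩ := hprim.eq_pow_of_pow_eq_one (ξ := m ^ 2)
    (by rw [hxy, hY, pow_orderOf_eq_one])
  have hj' : m ^ 2 = (l ^ j) ^ 2 := by rw [← hj, ← pow_mul, ← pow_mul, mul_comm]
  have htr := trace_pow_eq X l hl0 hl j
  have hinj := (algebraMap F (AlgebraicClosure F)).injective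
  have main : ∃ Z : SpecialLinearGroup (Fin 2) F, (Z : PSL2 F) = (Y : PSL2 F) ∧
      Z.1.trace = (X ^ j).1.trace := by
    rcases sq_eq_sq_iff_eq_or_eq_neg.1 hj' with h' | h'
    · refine ⟨Y, rfl, hinj ?_⟩
      rw [htr, ← hm, h']
    · refine ⟨-Y, mk_neg Y, hinj ?_⟩
      rw [htr, Matrix.SpecialLinearGroup.coe_neg, trace_neg, map_neg, ← hm, h', inv_neg]
      ring
  obtain ⟨Z, hZ, hZt⟩ := main
  obtain ⟨g, hg⟩ := isConj_of_trace_eq h2 (X ^ j) Z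
    (hZt ▸ key Z (by rw [hZ, hxy])) hZt.symm
  refine ⟨g, j, ?_⟩
  rw [← hZ, hg]
  rfl

theorem eq_top_of_closure_eq_top (A B : SpecialLinearGroup (Fin 2) F)
    (hAB : Subgroup.closure ({(A : PSL2 F), (B : PSL2 F)} : Set (PSL2 F)) = ⊤)
    (H : Subgroup (SpecialLinearGroup (Fin 2) F)) (hA : A ∈ H) (hB : B ∈ H)
    (hn : -1 ∈ H) : H = ⊤ := by
  rw [eq_top_iff]
  intro X _
  have h : (X : PSL2 F) ∈ H.map (QuotientGroup.mk' _) := by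
    have h1 : Subgroup.closure ({(A : PSL2 F), (B : PSL2 F)} : Set (PSL2 F)) ≤
        H.map (QuotientGroup.mk' _) := by
      rw [Subgroup.closure_le]
      rintro _ (rfl | rfl)
      · exact ⟨A, hA, rfl⟩
      · exact ⟨B, hB, rfl⟩
    rw [hAB] at h1
    exact h1 trivial
  obtain ⟨Y, hY, hYX⟩ := h
  have h2 : ((Y⁻¹ * X : SpecialLinearGroup (Fin 2) F) : PSL2 F) = 1 := by
    rw [QuotientGroup.mk_mul, QuotientGroup.mk_inv, ← hYX]
    exact inv_mul_cancel _
  rw [mk_eq_one_iff] at h2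
  have h3 : Y⁻¹ * X ∈ H := by
    rcases h2 with h2 | h2 <;> rw [h2]
    · exact H.one_mem
    · exact hn
  simpa using H.mul_mem hY h3

theorem trace_mem_of_closure_eq_top (k : Subring F) (A B : SpecialLinearGroup (Fin 2) F)
    (hAB : Subgroup.closure ({(A : PSL2 F), (B : PSL2 F)} : Set (PSL2 F)) = ⊤)
    (hA : A.1.trace ∈ k) (hB : B.1.trace ∈ k) (hC : (A * B).1.trace ∈ k)
    (X : SpecialLinearGroup (Fin 2) F) : X.1.trace ∈ k := by
  set R : Set (Matrix (Fin 2) (Fin 2) F) := {Y | ∃ x ∈ k, ∃ y ∈ k, ∃ z ∈ k, ∃ w ∈ k,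
    Y = x • (1 : Matrix (Fin 2) (Fin 2) F) + y • A.1 + z • B.1 + w • (A.1 * B.1)} with hR
  have hC' : (A.1 * B.1).trace ∈ k := hC
  have hinv (M : SpecialLinearGroup (Fin 2) F) : (M⁻¹).1 = M.1.trace • 1 - M.1 := by
    rw [Matrix.SpecialLinearGroup.coe_inv, adjugate_fin_two, trace_fin_two]
    ext i j
    fin_cases i <;> fin_cases j <;> simp
  have hAA := mul_self_of_det_eq_one A.1 A.2
  have hBB := mul_self_of_det_eq_one B.1 B.2
  have hBA : B.1 * A.1 = -(A.1 * B.1) + A.1.trace • B.1 + B.1.trace • A.1 +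
      ((A.1 * B.1).trace - A.1.trace * B.1.trace) • 1 := by
    ext i j
    fin_cases i <;> fin_cases j <;> simp [mul_apply, trace_fin_two] <;> ring
  have hAR : ∀ Y ∈ R, A.1 * Y ∈ R := by
    rintro _ ⟨x, hx, y, hy, z, hz, w, hw, rfl⟩
    refine ⟨-y, k.neg_mem hy, x + y * A.1.trace, k.add_mem hx (k.mul_mem hy hA),
      -w, k.neg_mem hw, z + w * A.1.trace, k.add_mem hz (k.mul_mem hw hA), ?_⟩
    simp only [mul_add, Matrix.mul_smul, mul_one, ← mul_assoc, hAA, sub_mul,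
      smul_mul_assoc, one_mul]
    module
  have hBR : ∀ Y ∈ R, B.1 * Y ∈ R := by
    rintro _ ⟨x, hx, y, hy, z, hz, w, hw, rfl⟩
    refine ⟨y * ((A.1 * B.1).trace - A.1.trace * B.1.trace) - z - w * A.1.trace, ?_,
      y * B.1.trace + w, ?_,
      x + y * A.1.trace + z * B.1.trace + w * (A.1 * B.1).trace, ?_, -y, k.neg_mem hy, ?_⟩
    · exact k.sub_mem (k.sub_mem (k.mul_mem hy (k.sub_mem hC' (k.mul_mem hA hB))) hz)
        (k.mul_mem hw hA)
    · exact k.add_mem (k.mul_mem hy hB) hw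
    · exact k.add_mem (k.add_mem (k.add_mem hx (k.mul_mem hy hA)) (k.mul_mem hz hB))
        (k.mul_mem hw hC')
    have hBAB : B.1 * (A.1 * B.1) = (A.1 * B.1).trace • B.1 + A.1 - A.1.trace • 1 := by
      rw [← mul_assoc, hBA]
      simp only [add_mul, neg_mul, mul_assoc, hBB, smul_mul_assoc, one_mul, mul_sub, mul_one,
        Matrix.mul_smul]
      module
    simp only [mul_add, Matrix.mul_smul, mul_one, hBAB, hBA, hBB]
    module
  have hsub : ∀ Y ∈ R, ∀ Z ∈ R, Y - Z ∈ R := by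
    rintro _ ⟨x, hx, y, hy, z, hz, w, hw, rfl⟩ _ ⟨x', hx', y', hy', z', hz', w', hw', rfl⟩
    refine ⟨x - x', k.sub_mem hx hx', y - y', k.sub_mem hy hy', z - z', k.sub_mem hz hz',
      w - w', k.sub_mem hw hw', ?_⟩
    module
  have hsmul : ∀ Y ∈ R, ∀ t ∈ k, t • Y ∈ R := by
    rintro _ ⟨x, hx, y, hy, z, hz, w, hw, rfl⟩ t ht
    refine ⟨t * x, k.mul_mem ht hx, t * y, k.mul_mem ht hy, t * z, k.mul_mem ht hz,
      t * w, k.mul_mem ht hw, ?_⟩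
    module
  have hinvR (M : SpecialLinearGroup (Fin 2) F) (hM : M.1.trace ∈ k)
      (h : ∀ Y ∈ R, M.1 * Y ∈ R) : ∀ Y ∈ R, (M⁻¹).1 * Y ∈ R := by
    intro Y hY
    rw [hinv, sub_mul, smul_mul_assoc, one_mul]
    exact hsub _ (hsmul _ hY _ hM) _ (h Y hY)
  let H : Subgroup (SpecialLinearGroup (Fin 2) F) :=
    { carrier := {M | (∀ Y ∈ R, M.1 * Y ∈ R) ∧ ∀ Y ∈ R, (M⁻¹).1 * Y ∈ R}
      mul_mem' := by
        rintro M N ⟨h1, h2⟩ ⟨h3, h4⟩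
        refine ⟨fun Y hY => ?_, fun Y hY => ?_⟩
        · rw [Matrix.SpecialLinearGroup.coe_mul, mul_assoc]
          exact h1 _ (h3 _ hY)
        · rw [_root_.mul_inv_rev, Matrix.SpecialLinearGroup.coe_mul, mul_assoc]
          exact h4 _ (h2 _ hY)
      one_mem' := by simp
      inv_mem' := by
        rintro M ⟨h1, h2⟩
        exact ⟨h2, by simpa using h1⟩ }
  have hneg : -1 ∈ H := by
    refine ⟨fun Y hY => ?_, fun Y hY => ?_⟩ <;>
    simpa using hsmul Y hY (-1) (k.neg_mem k.one_mem)
  have hH := eq_top_of_closure_eq_top A B hAB H ⟨hAR, hinvR A hA hAR⟩ ⟨hBR, hinvR B hB hBR⟩ hneg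
  have hX : X ∈ H := hH ▸ Subgroup.mem_top X
  have h1 : (1 : Matrix (Fin 2) (Fin 2) F) ∈ R :=
    ⟨1, k.one_mem, 0, k.zero_mem, 0, k.zero_mem, 0, k.zero_mem, by simp⟩
  obtain ⟨x, hx, y, hy, z, hz, w, hw, h⟩ := hX.1 1 h1
  rw [mul_one] at h
  rw [h]
  simp only [trace_add, trace_smul, smul_eq_mul, trace_one, Fintype.card_fin]
  exact k.add_mem (k.add_mem (k.add_mem (k.mul_mem hx (natCast_mem k 2)) (k.mul_mem hy hA))
    (k.mul_mem hz hB)) (k.mul_mem hw hC')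

theorem trace_mul_ne_of_closure_eq_top [Finite F] (p : ℕ) [hp : Fact p.Prime] [CharP F p]
    (hF : p < Nat.card F) (A B : SpecialLinearGroup (Fin 2) F)
    (hAB : Subgroup.closure ({(A : PSL2 F), (B : PSL2 F)} : Set (PSL2 F)) = ⊤)
    (hA : A.1.trace = 2) (hB : B.1.trace = 2) :
    ¬((A * B).1.trace = 2 ∨ (A * B).1.trace = -2) := by
  intro h
  set k := (ZMod.castHom (dvd_refl p) F).range
  have h2 : (2 : F) ∈ k := natCast_mem k 2
  have hall := trace_mem_of_closure_eq_top k A B hAB (hA ▸ h2) (hB ▸ h2)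
    (by rcases h with h | h <;> rw [h]; exacts [h2, k.neg_mem h2])
  have hsurj : Function.Surjective (ZMod.castHom (dvd_refl p) F) := by
    intro t
    have := hall ⟨!![t, -1; 1, 0], by simp⟩
    simpa [k, trace_fin_two] using this
  have := Nat.card_le_card_of_surjective _ hsurj
  rw [Nat.card_zmod] at this
  omega

/-- The upper unitriangular matrix with off-diagonal entry `α`. -/
def unipotent (α : F) : SpecialLinearGroup (Fin 2) F := ⟨!![1, α; 0, 1], by simp⟩

theorem exists_eq_conj_of_mul_eq (A B : SpecialLinearGroup (Fin 2) F)
    (g : Matrix (Fin 2) (Fin 2) F) (hg : g.det = 1) (h : A.1 * g = g * B.1) :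
    ∃ P : SpecialLinearGroup (Fin 2) F, A = P * B * P⁻¹ :=
  ⟨⟨g, hg⟩, eq_mul_inv_iff_mul_eq.2 (Subtype.ext h)⟩

theorem exists_conj_unipotent (A : SpecialLinearGroup (Fin 2) F) (hA : A.1.trace = 2)
    (hA1 : A ≠ 1) : ∃ α : F, α ≠ 0 ∧ ∃ g : SpecialLinearGroup (Fin 2) F,
      A = g * unipotent α * g⁻¹ := by
  have hdet := A.2
  rw [det_fin_two] at hdet
  rw [trace_fin_two] at hA
  by_cases hy : A.1 0 1 = 0
  · have h0 : A.1 0 0 = 1 := by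
      have : (A.1 0 0 - 1) ^ 2 = 0 := by
        rw [hy] at hdet
        linear_combination A.1 0 0 * hA - hdet
      exact sub_eq_zero.1 (pow_eq_zero_iff two_ne_zero |>.1 this)
    have h1 : A.1 1 1 = 1 := by linear_combination hA - h0
    refine ⟨-A.1 1 0, ?_, exists_eq_conj_of_mul_eq _ _ !![0, -1; 1, 0] (by simp) ?_⟩
    · intro h
      apply hA1
      ext i j
      fin_cases i <;> fin_cases j <;> simp [hy, h0, h1]
      simpa using h
    · ext i j
      fin_cases i <;> fin_cases j <;> simp [unipotent, mul_apply, hy, h0, h1]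
  · refine ⟨A.1 0 1, hy, exists_eq_conj_of_mul_eq _ _ !![1, 0; (1 - A.1 0 0) / A.1 0 1, 1]
      (by simp) ?_⟩
    ext i j
    fin_cases i <;> fin_cases j <;> simp [unipotent, mul_apply] <;> field_simp
    · ring
    · linear_combination hA - hdet
    · linear_combination hA

theorem isConj_unipotent (α s : F) (hs : s ≠ 0) :
    ∃ g : SpecialLinearGroup (Fin 2) F, unipotent (α * s ^ 2) = g * unipotent α * g⁻¹ := by
  refine exists_eq_conj_of_mul_eq _ _ !![s, 0; 0, s⁻¹] (by simp [hs]) ?_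
  ext i j
  fin_cases i <;> fin_cases j <;> simp [unipotent, mul_apply]
  field_simp

theorem trace_conj (g M : SpecialLinearGroup (Fin 2) F) :
    (g * M * g⁻¹).1.trace = M.1.trace := by
  rw [Matrix.SpecialLinearGroup.coe_mul, trace_mul_comm, ← Matrix.SpecialLinearGroup.coe_mul,
    inv_mul_cancel_left]

theorem trace_conj_unipotent_mul (α β : F) (g h : SpecialLinearGroup (Fin 2) F) :
    ∃ k : F, (g * unipotent α * g⁻¹ * (h * unipotent β * h⁻¹)).1.trace = 2 - α * β * k ^ 2 := by
  have h1 : (g * unipotent α * g⁻¹ * (h * unipotent β * h⁻¹)).1.trace =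
      (unipotent α * (g⁻¹ * h) * unipotent β * (g⁻¹ * h)⁻¹).1.trace := by
    rw [← trace_conj g⁻¹]
    refine congrArg (fun M : SpecialLinearGroup (Fin 2) F => M.1.trace) ?_
    group
  rw [h1]
  generalize g⁻¹ * h = k
  have hdet := k.2
  rw [det_fin_two] at hdet
  refine ⟨k.1 1 0, ?_⟩
  rw [Matrix.SpecialLinearGroup.coe_mul, Matrix.SpecialLinearGroup.coe_mul,
    Matrix.SpecialLinearGroup.coe_mul, Matrix.SpecialLinearGroup.coe_inv, adjugate_fin_two,
    trace_fin_two]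
  simp only [unipotent, mul_apply, Fin.sum_univ_two]
  simp
  linear_combination 2 * hdet

theorem isSquare_mul_of_not_isSquare [Finite F] (a b c : F) (hc : c ≠ 0)
    (ha : ¬ IsSquare (c * a)) (hb : ¬ IsSquare (c * b)) : IsSquare (a * b) := by
  classical
  have := Fintype.ofFinite F
  have ha0 : a ≠ 0 := by rintro rfl; simp at ha
  have hb0 : b ≠ 0 := by rintro rfl; simp at hb
  rw [← quadraticChar_neg_one_iff_not_isSquare] at ha hb
  rw [← quadraticChar_one_iff_isSquare (mul_ne_zero ha0 hb0)]
  rw [map_mul] at ha hb ⊢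
  have h := quadraticChar_sq_one hc
  linear_combination ha * (quadraticChar F c * quadraticChar F b) - hb -
    quadraticChar F a * quadraticChar F b * h

theorem exists_trace_eq_two_sub_sq [Finite F] (p : ℕ) [hp : Fact p.Prime] [CharP F p]
    (hodd : Odd p) (a b u : PSL2 F) (ha : orderOf a = p) (hb : orderOf b = p)
    (hu : orderOf u = p) (hua : ∀ g, u ≠ g * a * g⁻¹) (hub : ∀ g, u ≠ g * b * g⁻¹) :
    ∃ A B : SpecialLinearGroup (Fin 2) F, (A : PSL2 F) = a ∧ (B : PSL2 F) = b ∧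
      A.1.trace = 2 ∧ B.1.trace = 2 ∧ ∃ d, (A * B).1.trace = 2 - d ^ 2 := by
  have key : ∀ x : PSL2 F, orderOf x = p → ∃ X : SpecialLinearGroup (Fin 2) F,
      (X : PSL2 F) = x ∧ X.1.trace = 2 ∧ ∃ α, α ≠ 0 ∧ ∃ g, X = g * unipotent α * g⁻¹ := by
    intro x hx
    obtain ⟨X, hX, ht⟩ := exists_lift_trace_eq_two p hodd x (hx ▸ pow_orderOf_eq_one x)
    refine ⟨X, hX, ht, exists_conj_unipotent X ht ?_⟩
    rintro rfl
    rw [← hX, QuotientGroup.mk_one, orderOf_one] at hx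
    exact hp.out.one_lt.ne hx
  have conj : ∀ (g h : SpecialLinearGroup (Fin 2) F) (α β : F), α ≠ 0 → β ≠ 0 →
      IsSquare (β * α) → ∃ k, h * unipotent β * h⁻¹ = k * (g * unipotent α * g⁻¹) * k⁻¹ := by
    rintro g h α β hα hβ ⟨s, hs⟩
    have hs0 : s ≠ 0 := by
      rintro rfl
      simp [hα, hβ] at hs
    obtain ⟨k, hk⟩ := isConj_unipotent α (s / α) (div_ne_zero hs0 hα)
    have : α * (s / α) ^ 2 = β := by
      field_simp
      linear_combination -hs
    rw [this] at hk
    refine ⟨h * k * g⁻¹, ?_⟩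
    rw [hk]
    group
  obtain ⟨A, rfl, hAt, α, hα, g, hA⟩ := key a ha
  obtain ⟨B, rfl, hBt, β, hβ, h, hB⟩ := key b hb
  obtain ⟨U, rfl, hUt, γ, hγ, l, hU⟩ := key u hu
  obtain ⟨s, hs⟩ := isSquare_mul_of_not_isSquare α β γ hγ
    (fun hsq => by
      obtain ⟨k, hk⟩ := conj g l α γ hα hγ hsq
      apply hua k
      rw [hU, hk, ← hA]
      rfl)
    (fun hsq => by
      obtain ⟨k, hk⟩ := conj h l β γ hβ hγ hsq
      apply hub k
      rw [hU, hk, ← hB]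
      rfl)
  obtain ⟨k, hk⟩ := trace_conj_unipotent_mul α β g h
  refine ⟨A, B, rfl, rfl, hAt, hBt, s * k, ?_⟩
  rw [hA, hB, hk, hs]
  ring

end PSL2
end TwoByTwo
section Group

variable {G : Type*} [Group G]

theorem mem_sigma3_of_mem {a b c x : G} (hx : x ∈ ({a, b, c} : Set G)) (g : G) (j : ℕ) :
    g * x ^ j * g⁻¹ ∈ sigma3 a b c := by
  rcases hx with rfl | rfl | rfl
  · exact Or.inl (Or.inl ⟨g, j, rfl⟩)
  · exact Or.inl (Or.inr ⟨g, j, rfl⟩)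
  · exact Or.inr ⟨g, j, rfl⟩

theorem exists_prime_dvd_orderOf {a b c : G} {l : ℕ} (hl : l.Prime)
    (h : l ∣ orderOf a * orderOf b * orderOf c) : ∃ x ∈ ({a, b, c} : Set G), l ∣ orderOf x := by
  rw [hl.dvd_mul, hl.dvd_mul] at h
  rcases h with (h | h) | h
  · exact ⟨a, by simp, h⟩
  · exact ⟨b, by simp, h⟩
  · exact ⟨c, by simp, h⟩

theorem closure_pair_eq_top {a b x y : G} (h : Subgroup.closure ({a, b} : Set G) = ⊤)
    (ha : a ∈ Subgroup.closure ({x, y} : Set G)) (hb : b ∈ Subgroup.closure ({x, y} : Set G)) :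
    Subgroup.closure ({x, y} : Set G) = ⊤ := by
  rw [eq_top_iff, ← h, Subgroup.closure_le]
  rintro _ (rfl | rfl)
  · exact ha
  · exact hb

theorem closure_rotate {a b c : G} (habc : a * b * c = 1)
    (h : Subgroup.closure ({a, b} : Set G) = ⊤) :
    b * c * a = 1 ∧ Subgroup.closure ({b, c} : Set G) = ⊤ := by
  have h1 : a = (b * c)⁻¹ := by
    rw [eq_inv_iff_mul_eq_one, ← mul_assoc, habc]
  refine ⟨by rw [h1]; simp, ?_⟩
  have hb : b ∈ Subgroup.closure ({b, c} : Set G) := Subgroup.subset_closure (by simp)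
  have hc : c ∈ Subgroup.closure ({b, c} : Set G) := Subgroup.subset_closure (by simp)
  refine closure_pair_eq_top h ?_ hb
  rw [h1]
  exact Subgroup.inv_mem _ (Subgroup.mul_mem _ hb hc)

theorem IsUnmixedBeauville.symm {a₁ b₁ c₁ a₂ b₂ c₂ : G}
    (h : IsUnmixedBeauville a₁ b₁ c₁ a₂ b₂ c₂) : IsUnmixedBeauville a₂ b₂ c₂ a₁ b₁ c₁ :=
  ⟨h.2.1, h.1, h.2.2.2.1, h.2.2.1, by rw [Set.inter_comm]; exact h.2.2.2.2⟩

theorem IsUnmixedBeauville.ne_conj_pow {a₁ b₁ c₁ a₂ b₂ c₂ : G}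
    (h : IsUnmixedBeauville a₁ b₁ c₁ a₂ b₂ c₂) {x y : G} (hx : x ∈ ({a₁, b₁, c₁} : Set G))
    (hy : y ∈ ({a₂, b₂, c₂} : Set G)) (g : G) (i j : ℕ) (hyi : y ^ i ≠ 1) :
    y ^ i ≠ g * x ^ j * g⁻¹ := by
  intro he
  apply hyi
  have h1 : y ^ i ∈ sigma3 a₂ b₂ c₂ := by simpa using mem_sigma3_of_mem hy 1 i
  have h2 : y ^ i ∈ sigma3 a₁ b₁ c₁ := he ▸ mem_sigma3_of_mem hx g j
  have h3 : y ^ i ∈ sigma3 a₁ b₁ c₁ ∩ sigma3 a₂ b₂ c₂ := ⟨h2, h1⟩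
  rw [h.2.2.2.2] at h3
  exact h3

end Group

theorem multiset_triple_cases {x y z p n : ℕ} (h : ({x, y, z} : Multiset ℕ) = {p, p, n}) :
    (x = p ∧ y = p ∧ z = n) ∨ (y = p ∧ z = p ∧ x = n) ∨ (z = p ∧ x = p ∧ y = n) := by
  simp only [Multiset.insert_eq_cons, Multiset.cons_eq_cons, Multiset.singleton_eq_cons_iff] at h
  grind [Multiset.singleton_inj, Multiset.cons_zero]

theorem not_prime_pow_three_dvd {p r s t : ℕ} (hp : p.Prime) (hr0 : r ≠ 0) (hs0 : s ≠ 0)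
    (ht0 : t ≠ 0) (hr : p ∣ r → r = p) (hs : p ∣ s → s = p) (ht : p ∣ t → t = p)
    (h : ¬(r = p ∧ s = p ∧ t = p)) : ¬ p ^ 3 ∣ r * s * t := by
  have key : ∀ n : ℕ, n ≠ 0 → (p ∣ n → n = p) →
      n.factorization p ≤ 1 ∧ (n ≠ p → n.factorization p = 0) := by
    intro n hn h
    by_cases hd : p ∣ n
    · rw [h hd]
      simp [hp.factorization_self]
    · simp [Nat.factorization_eq_zero_of_not_dvd hd]
  rw [hp.pow_dvd_iff_le_factorization (by positivity),
    Nat.factorization_mul (by positivity) ht0, Nat.factorization_mul hr0 hs0]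
  simp only [Finsupp.add_apply]
  have h1 := key r hr0 hr
  have h2 := key s hs0 hs
  have h3 := key t ht0 ht
  by_cases e1 : r = p
  · by_cases e2 : s = p
    · have := h3.2 fun e3 => h ⟨e1, e2, e3⟩
      omega
    · have := h2.2 e2
      omega
  · have := h1.2 e1
    omega

namespace PSL2

variable {F : Type*} [Field F]

theorem prime_eq_char_of_dvd [Finite F] (p : ℕ) [hp : Fact p.Prime] [CharP F p]
    (h2 : (2 : F) ≠ 0) {a₁ b₁ c₁ a₂ b₂ c₂ : PSL2 F} (h : IsUnmixedBeauville a₁ b₁ c₁ a₂ b₂ c₂)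
    {l : ℕ} (hl : l.Prime) (hl1 : l ∣ orderOf a₁ * orderOf b₁ * orderOf c₁)
    (hl2 : l ∣ orderOf a₂ * orderOf b₂ * orderOf c₂) : l = p := by
  by_contra hlp
  obtain ⟨x, hx, hlx⟩ := exists_prime_dvd_orderOf hl hl1
  obtain ⟨y, hy, hly⟩ := exists_prime_dvd_orderOf hl hl2
  have ox := orderOf_pow_orderOf_div (orderOf_pos x).ne' hlx
  have oy := orderOf_pow_orderOf_div (orderOf_pos y).ne' hly
  have hne : ∀ z : PSL2 F, orderOf z = l → z ≠ 1 := by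
    rintro z hz rfl
    rw [orderOf_one] at hz
    exact hl.one_lt.ne hz
  obtain ⟨g, j, hg⟩ := exists_conj_pow_eq p h2 _ _ (ox.trans oy.symm)
    (by rw [ox, Nat.prime_dvd_prime_iff_eq hp.out hl]; exact Ne.symm hlp) (hne _ ox)
  rw [← pow_mul] at hg
  exact h.ne_conj_pow hx hy g _ _ (hne _ oy) hg

theorem orderOf_eq_of_lifts (A B : SpecialLinearGroup (Fin 2) F) (c : PSL2 F)
    (h : (A : PSL2 F) * B * c = 1) :
    orderOf c = orderOf ((A * B : SpecialLinearGroup (Fin 2) F) : PSL2 F) := by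
  rw [QuotientGroup.mk_mul, eq_inv_of_mul_eq_one_left h, orderOf_inv]

theorem orderOf_ne_char [Finite F] (p : ℕ) [hp : Fact p.Prime] [CharP F p]
    (hodd : Odd p) (h2 : (2 : F) ≠ 0) (hF : p < Nat.card F) {a b c : PSL2 F} (habc : a * b * c = 1)
    (hab : Subgroup.closure ({a, b} : Set (PSL2 F)) = ⊤)
    (ha : orderOf a = p) (hb : orderOf b = p) : orderOf c ≠ p := by
  obtain ⟨A, rfl, hA⟩ := exists_lift_trace_eq_two p hodd a (ha ▸ pow_orderOf_eq_one a)
  obtain ⟨B, rfl, hB⟩ := exists_lift_trace_eq_two p hodd b (hb ▸ pow_orderOf_eq_one b)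
  rw [orderOf_eq_of_lifts A B c habc]
  intro h
  exact not_char_dvd_orderOf_mk p h2 _
    (trace_mul_ne_of_closure_eq_top p hF A B hab hA hB) h.symm.dvd

end PSL2

theorem orderOf_eq_two_mul {K : Type*} [Field K] (h2 : (2 : K) ≠ 0) {a : K} {n : ℕ} (hn : 0 < n)
    (ha : orderOf (a ^ 2) = n) (han : a ^ n = -1) : orderOf a = 2 * n := by
  have h1 : a ^ (2 * n) = 1 := by rw [mul_comm, pow_mul, han]; simp
  have hfin : IsOfFinOrder a := isOfFinOrder_iff_pow_eq_one.2 ⟨2 * n, by omega, h1⟩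
  have h3 := hfin.orderOf_pow (n := 2)
  rw [ha] at h3
  rcases (Nat.dvd_prime Nat.prime_two).1 (Nat.gcd_dvd_right (orderOf a) 2) with h | h
  · rw [h, Nat.div_one] at h3
    rw [h3, pow_orderOf_eq_one] at han
    exact absurd (by linear_combination han : (2 : K) = 0) h2
  · have h4 := Nat.gcd_dvd_left (orderOf a) 2
    rw [h] at h3 h4
    omega

theorem exists_orderOf_eq_two_mul {K : Type*} [Field K] (h2 : (2 : K) ≠ 0) {c : K} {n N : ℕ}
    (hn : 0 < n) (hN : Even N) (hc : c ^ N = 1) (ho : orderOf ((-c ^ 2) ^ 2) = n) :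
    n ∣ N / 2 ∧ ∃ a : K, orderOf a = 2 * n ∧ ∃ d : K, -a = d ^ 2 ∧ d ^ N = 1 := by
  set l := -c ^ 2 with hl
  have hlN : l ^ N = 1 := by
    rw [hl, hN.neg_pow, ← pow_mul, mul_comm, pow_mul, hc, one_pow]
  refine ⟨?_, ?_⟩
  · rw [← ho]
    apply orderOf_dvd_of_pow_eq_one
    rw [← pow_mul, Nat.mul_div_cancel' hN.two_dvd, hlN]
  have h1 : l ^ n = 1 ∨ l ^ n = -1 := by
    rw [← sq_eq_one_iff, ← pow_mul, mul_comm, pow_mul, ← ho, pow_orderOf_eq_one]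
  rcases h1 with h1 | h1
  · have hodd : Odd n := by
      rw [← Nat.not_even_iff_odd]
      intro hev
      have h3 : (l ^ 2) ^ (n / 2) = 1 := by
        rw [← pow_mul, Nat.mul_div_cancel' hev.two_dvd, h1]
      have h4 := orderOf_dvd_of_pow_eq_one h3
      rw [ho] at h4
      have := Nat.le_of_dvd (by obtain ⟨k, rfl⟩ := hev; omega) h4
      omega
    refine ⟨-l, orderOf_eq_two_mul h2 hn (by rwa [neg_sq]) (by rw [hodd.neg_pow, h1]),
      l ^ ((n + 1) / 2), ?_, ?_⟩
    · rw [neg_neg, ← pow_mul, Nat.div_mul_cancel hodd.add_one.two_dvd, pow_succ, h1, one_mul]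
    · rw [← pow_mul, mul_comm, pow_mul, hlN, one_pow]
  · exact ⟨l, orderOf_eq_two_mul h2 hn ho h1, c, by rw [hl, neg_neg], hc⟩

namespace PSL2

theorem two_ne_zero_of_odd (F : Type*) [Field F] (p : ℕ) [CharP F p] (hodd : Odd p) :
    (2 : F) ≠ 0 := by
  apply Ring.two_ne_zero
  rw [ringChar.eq F p]
  rintro rfl
  exact absurd hodd (by decide)

theorem isGoodGOrder_orderOf_mk (p e : ℕ) [hp : Fact p.Prime] (hodd : Odd p) (he0 : e ≠ 0)
    (X : SpecialLinearGroup (Fin 2) (GaloisField p e)) (d : GaloisField p e)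
    (hd : X.1.trace = 2 - d ^ 2) (hX : ¬(X.1.trace = 2 ∨ X.1.trace = -2)) :
    IsGoodGOrder p e (orderOf (X : PSL2 (GaloisField p e))) := by
  have hpos := orderOf_pos (X : PSL2 (GaloisField p e))
  have hcard : Nat.card (GaloisField p e) = p ^ e := GaloisField.card p e he0
  have hcardK : Nat.card (GaloisField p (2 * e)) = p ^ (2 * e) :=
    GaloisField.card p (2 * e) (by omega)
  have hqodd : Odd (p ^ e) := hodd.pow
  have hF2 := two_ne_zero_of_odd (GaloisField p e) p hodd
  have hK2 := two_ne_zero_of_odd (GaloisField p (2 * e)) p hodd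
  have hFpow (x : GaloisField p e) : x ^ p ^ e = x := by
    have := Fintype.ofFinite (GaloisField p e)
    rw [← hcard, Nat.card_eq_fintype_card, FiniteField.pow_card]
  refine ⟨?_, ?_⟩
  · rcases Nat.eq_or_lt_of_le hpos with h1 | h1
    · exfalso
      apply hX
      have h3 : (X : PSL2 (GaloisField p e)) = 1 := orderOf_eq_one_iff.1 (by omega)
      rw [mk_eq_one_iff] at h3
      rcases h3 with rfl | rfl
      · left; simp
      · right; simp
    · omega
  have trace_eq {L : Type} [Field L] [Algebra (GaloisField p e) L] (c : L) (hc0 : c ≠ 0)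
      (hc : c + c⁻¹ = algebraMap (GaloisField p e) L d) :
      orderOf (X : PSL2 (GaloisField p e)) = orderOf ((-c ^ 2) ^ 2) := by
    refine orderOf_mk X (-c ^ 2) (by simpa using hc0) ?_ hX
    rw [hd, map_sub, map_pow, ← hc, map_ofNat]
    field_simp
    ring
  by_cases hD : IsSquare (d ^ 2 - 4)
  · left
    obtain ⟨δ, hδ⟩ := hD
    obtain ⟨c, hc0, hc, -⟩ := exists_add_inv_eq hF2 d δ (by rw [hδ, sq])
    have hcq : c ^ (p ^ e - 1) = 1 := by
      apply mul_right_cancel₀ hc0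
      rw [← pow_succ, Nat.sub_add_cancel hqodd.pos, hFpow, one_mul]
    obtain ⟨h1, a, ha, b, hb, -⟩ := exists_orderOf_eq_two_mul hF2 hpos
      (Nat.Odd.sub_odd hqodd odd_one) hcq (trace_eq (L := GaloisField p e) c hc0 hc).symm
    exact ⟨h1, a, ha, b, hb⟩
  · right
    obtain ⟨φ⟩ : Nonempty (GaloisField p e →ₐ[ZMod p] GaloisField p (2 * e)) := by
      apply FiniteField.nonempty_algHom_of_finrank_dvd
      rw [GaloisField.finrank p he0, GaloisField.finrank p (by omega)]
      exact dvd_mul_left _ _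
    let _ : Algebra (GaloisField p e) (GaloisField p (2 * e)) := φ.toRingHom.toAlgebra
    let ι := algebraMap (GaloisField p e) (GaloisField p (2 * e))
    have hD0 : d ^ 2 - 4 ≠ 0 := fun h => hD (h ▸ IsSquare.zero)
    have := Fintype.ofFinite (GaloisField p e)
    have := Fintype.ofFinite (GaloisField p (2 * e))
    have hrF : ringChar (GaloisField p e) ≠ 2 := by
      rw [ringChar.eq (GaloisField p e) p]; rintro rfl; exact absurd hodd (by decide)
    have hrK : ringChar (GaloisField p (2 * e)) ≠ 2 := by
      rw [ringChar.eq (GaloisField p (2 * e)) p]; rintro rfl; exact absurd hodd (by decide)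
    have hFc : Fintype.card (GaloisField p e) = p ^ e := by rw [← Nat.card_eq_fintype_card, hcard]
    have hKc : Fintype.card (GaloisField p (2 * e)) = p ^ (2 * e) := by
      rw [← Nat.card_eq_fintype_card, hcardK]
    have hpow : (d ^ 2 - 4) ^ (p ^ e / 2) = -1 := by
      have h1 := FiniteField.isSquare_iff hrF hD0
      have h3 := FiniteField.pow_dichotomy hrF hD0
      rw [hFc] at h1 h3
      exact h3.resolve_left fun h => hD (h1.2 h)
    obtain ⟨k, hk⟩ := hqodd
    have hk2 : p ^ e / 2 = k := by omega
    rw [hk2] at hpow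
    have hpowK : (ι (d ^ 2 - 4)) ^ k = -1 := by
      rw [← map_pow, hpow, map_neg, map_one]
    have hsq : IsSquare (ι (d ^ 2 - 4)) := by
      rw [FiniteField.isSquare_iff hrK ((map_ne_zero ι).2 hD0), hKc]
      have h1 : p ^ (2 * e) / 2 = k * (2 * (k + 1)) := by
        rw [mul_comm 2 e, pow_mul, hk, show (2 * k + 1) ^ 2 = 2 * (k * (2 * (k + 1))) + 1 by ring]
        omega
      rw [h1, pow_mul, hpowK, pow_mul]
      simp
    obtain ⟨δ, hδ⟩ := hsq
    obtain ⟨c, hc0, hc, hcδ⟩ := exists_add_inv_eq hK2 (ι d) δ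
      (by rw [sq δ, ← hδ, map_sub, map_pow, map_ofNat])
    have hδq : δ ^ p ^ e = -δ := by
      rw [hk, pow_succ, pow_mul, sq, ← hδ, hpowK]
      ring
    have hmapq (x : GaloisField p e) : (ι x) ^ p ^ e = ι x := by
      rw [← map_pow, hFpow]
    have hcq : c ^ p ^ e = c⁻¹ := by
      apply mul_left_cancel₀ hK2
      have h1 := congrArg (· ^ p ^ e) hcδ
      simp only [mul_pow, add_pow_char_pow, hδq, hmapq] at h1
      rw [← map_ofNat ι 2, hmapq] at h1
      rw [← map_ofNat ι 2, h1, map_ofNat]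
      linear_combination hcδ - 2 * hc
    have hcq1 : c ^ (p ^ e + 1) = 1 := by rw [pow_succ, hcq, inv_mul_cancel₀ hc0]
    obtain ⟨h1, a, ha, b, hb, hb1⟩ := exists_orderOf_eq_two_mul hK2 hpos
      (by rw [hk]; exact ⟨k + 1, by ring⟩ : Even (p ^ e + 1)) hcq1
      (trace_eq (L := GaloisField p (2 * e)) c hc0 hc).symm
    exact ⟨h1, a, ha, b, hb, hb1⟩

theorem isGoodGOrder_of_triple (p e : ℕ) [hp : Fact p.Prime] (hodd : Odd p) (he : 1 < e)
    {a b c u : PSL2 (GaloisField p e)} (habc : a * b * c = 1)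
    (hab : Subgroup.closure ({a, b} : Set (PSL2 (GaloisField p e))) = ⊤)
    (ha : orderOf a = p) (hb : orderOf b = p)
    (hu : orderOf u = p) (hua : ∀ g, u ≠ g * a * g⁻¹) (hub : ∀ g, u ≠ g * b * g⁻¹) :
    IsGoodGOrder p e (orderOf c) := by
  obtain ⟨A, B, rfl, rfl, hA, hB, d, hd⟩ :=
    exists_trace_eq_two_sub_sq p hodd a b u ha hb hu hua hub
  rw [orderOf_eq_of_lifts A B c habc]
  refine isGoodGOrder_orderOf_mk p e hodd (by omega) _ d hd
    (trace_mul_ne_of_closure_eq_top p ?_ A B hab hA hB)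
  rw [GaloisField.card p e (by omega)]
  exact lt_self_pow₀ hp.out.one_lt he

theorem isGoodGOrder_of_beauville (p e : ℕ) [hp : Fact p.Prime] (hodd : Odd p) (he : 1 < e)
    {a₁ b₁ c₁ a₂ b₂ c₂ : PSL2 (GaloisField p e)} (h : IsUnmixedBeauville a₁ b₁ c₁ a₂ b₂ c₂)
    (hp2 : p ∣ orderOf a₂ * orderOf b₂ * orderOf c₂) (n : ℕ)
    (hn : ({orderOf a₁, orderOf b₁, orderOf c₁} : Multiset ℕ) = {p, p, n}) :
    n ≠ p ∧ IsGoodGOrder p e n := by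
  have h2 := two_ne_zero_of_odd (GaloisField p e) p hodd
  have hF : p < Nat.card (GaloisField p e) := by
    rw [GaloisField.card p e (by omega)]
    exact lt_self_pow₀ hp.out.one_lt he
  obtain ⟨u, hu, hpu⟩ := exists_prime_dvd_orderOf hp.out hp2
  have hup := orderOf_eq_of_dvd p h2 u hpu
  have hu1 : u ≠ 1 := by
    rintro rfl
    rw [orderOf_one] at hup
    exact hp.out.one_lt.ne hup
  have hconj : ∀ x ∈ ({a₁, b₁, c₁} : Set (PSL2 (GaloisField p e))), ∀ g, u ≠ g * x * g⁻¹ := by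
    intro x hx g
    simpa using h.ne_conj_pow hx hu g 1 1 (by simpa using hu1)
  have main : ∀ x y z : PSL2 (GaloisField p e), x * y * z = 1 →
      Subgroup.closure ({x, y} : Set (PSL2 (GaloisField p e))) = ⊤ →
      x ∈ ({a₁, b₁, c₁} : Set (PSL2 (GaloisField p e))) →
      y ∈ ({a₁, b₁, c₁} : Set (PSL2 (GaloisField p e))) →
      orderOf x = p → orderOf y = p → orderOf z = n → n ≠ p ∧ IsGoodGOrder p e n := by
    rintro x y z hxyz hxy hx hy hxp hyp rfl
    exact ⟨orderOf_ne_char p hodd h2 hF hxyz hxy hxp hyp,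
      isGoodGOrder_of_triple p e hodd he hxyz hxy hxp hyp hup (hconj x hx) (hconj y hy)⟩
  have r0 := h.1
  have g0 := h.2.2.1
  obtain ⟨r1, g1⟩ := closure_rotate r0 g0
  obtain ⟨r2, g2⟩ := closure_rotate r1 g1
  have hcases : (orderOf a₁ = p ∧ orderOf b₁ = p ∧ orderOf c₁ = n) ∨
      (orderOf b₁ = p ∧ orderOf c₁ = p ∧ orderOf a₁ = n) ∨
      (orderOf c₁ = p ∧ orderOf a₁ = p ∧ orderOf b₁ = n) := multiset_triple_cases hn
  rcases hcases with ⟨e1, e2, e3⟩ | ⟨e1, e2, e3⟩ | ⟨e1, e2, e3⟩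
  · exact main _ _ _ r0 g0 (by simp) (by simp) e1 e2 e3
  · exact main _ _ _ r1 g1 (by simp) (by simp) e1 e2 e3
  · exact main _ _ _ r2 g2 (by simp) (by simp) e1 e2 e3

theorem not_pow_three_dvd_of_closure_eq_top (p e : ℕ) [hp : Fact p.Prime] (hodd : Odd p)
    (he : 1 < e) {a b c : PSL2 (GaloisField p e)} (habc : a * b * c = 1)
    (hab : Subgroup.closure ({a, b} : Set (PSL2 (GaloisField p e))) = ⊤) :
    ¬ p ^ 3 ∣ orderOf a * orderOf b * orderOf c := by
  have h2 := two_ne_zero_of_odd (GaloisField p e) p hodd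
  have hF : p < Nat.card (GaloisField p e) := by
    rw [GaloisField.card p e (by omega)]
    exact lt_self_pow₀ hp.out.one_lt he
  exact not_prime_pow_three_dvd hp.out (orderOf_pos a).ne' (orderOf_pos b).ne' (orderOf_pos c).ne'
    (orderOf_eq_of_dvd p h2 a) (orderOf_eq_of_dvd p h2 b) (orderOf_eq_of_dvd p h2 c)
    fun ⟨ha, hb, hc⟩ => orderOf_ne_char p hodd h2 hF habc hab ha hb hc

end PSL2

/-- Let `G = PSL₂(q)` with `q = p ^ e > 9`, `p` an odd prime, `e` even.
If `G` admits an unmixed Beauville structure of type `((r₁,s₁,t₁),(r₂,s₂,t₂))`, then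
`gcd(r₁s₁t₁, r₂s₂t₂) ∈ {1, p, p²}`; moreover, if `p` divides this gcd and one of the two
triples is, up to permutation, `(p, p, n)`, then `n ≠ p` and `n` is a good `G`-order. -/
theorem gcd_of_beauville_type_PSL2 (p e : ℕ) [hp : Fact p.Prime] (hodd : Odd p)
    (he : Even e) (he0 : 0 < e) (hq : 9 < p ^ e)
    (r₁ s₁ t₁ r₂ s₂ t₂ : ℕ)
    (h : HasBeauvilleOfType (PSL2 (GaloisField p e)) r₁ s₁ t₁ r₂ s₂ t₂) :
    Nat.gcd (r₁ * s₁ * t₁) (r₂ * s₂ * t₂) ∈ ({1, p, p ^ 2} : Set ℕ) ∧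
    (p ∣ Nat.gcd (r₁ * s₁ * t₁) (r₂ * s₂ * t₂) →
      ∀ n : ℕ,
        (({r₁, s₁, t₁} : Multiset ℕ) = {p, p, n} ∨
          ({r₂, s₂, t₂} : Multiset ℕ) = {p, p, n}) →
        n ≠ p ∧ IsGoodGOrder p e n) := by
  obtain ⟨a₁, b₁, c₁, a₂, b₂, c₂, hB, rfl, rfl, rfl, rfl, rfl, rfl⟩ := h
  have he1 : 1 < e := by
    obtain ⟨k, rfl⟩ := he
    omega
  have h2 := PSL2.two_ne_zero_of_odd (GaloisField p e) p hodd
  refine ⟨?_, fun hpg n hn => ?_⟩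
  · set g := Nat.gcd (orderOf a₁ * orderOf b₁ * orderOf c₁)
      (orderOf a₂ * orderOf b₂ * orderOf c₂) with hg
    have hg0 : g ≠ 0 := Nat.gcd_ne_zero_left
      (mul_pos (mul_pos (orderOf_pos a₁) (orderOf_pos b₁)) (orderOf_pos c₁)).ne'
    have hgp := Nat.eq_prime_pow_of_unique_prime_dvd (p := p) hg0 fun {l} hl hlg =>
      PSL2.prime_eq_char_of_dvd p h2 hB hl (hlg.trans (Nat.gcd_dvd_left _ _))
        (hlg.trans (Nat.gcd_dvd_right _ _))
    have h3 : ¬ p ^ 3 ∣ g := fun h =>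
      PSL2.not_pow_three_dvd_of_closure_eq_top p e hodd he1 hB.1 hB.2.2.1
        (h.trans (Nat.gcd_dvd_left _ _))
    generalize g.primeFactorsList.length = k at hgp
    have hk : k < 3 := by
      by_contra hk
      exact h3 (hgp ▸ pow_dvd_pow p (not_lt.1 hk))
    rw [hgp]
    interval_cases k <;> simp
  · rcases hn with hn | hn
    · exact PSL2.isGoodGOrder_of_beauville p e hodd he1 hB (hpg.trans (Nat.gcd_dvd_right _ _)) n hn
    · exact PSL2.isGoodGOrder_of_beauville p e hodd he1 hB.symm
        (hpg.trans (Nat.gcd_dvd_left _ _)) n hn
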